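/- arXiv:1311.4473 — 4 statements merged into one kernel-verified Lean document; each statement's English description precedes it below -/
import Mathlib

section
/- For all functions a, b : Fin n → ℕ, one has the operator identity (∏_{j} X̂_j^{a_j}) ∘ (∏_{j} D_j^{b_j}) ∘ (∏_{j} D_j^{a_j}) ∘ (∏_{j} X̂_j^{b_j}) = (∏_{j} ∏_{k=0}^{a_j−1} (E_j − k·id)) ∘ (∏_{j} ∏_{k=1}^{b_j} (E_j + k·id)) in End_R(R[X_1,…,X_n]); all factors appearing in each displayed product pairwise commute, so the products are unambiguous. (This is the identity f̃_v · g̃_v = ∏_j ∏_{k=0}^{⟨v,ẽ_j⟩−1}(E_j−k) · ∏_j ∏_{k=1}^{⟨v,ẽ_{n+j}⟩}(E_j+k) from the paper's proof of the existence of integral localizing parameters for hypertoric varieties in characteristic p.) -/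
open MvPolynomial

/-- Multiplication by the variable `X j`, as an `R`-linear endomorphism of
`R[X_1, …, X_n]`. -/
noncomputable def Xhat {R : Type*} [CommRing R] {n : ℕ} (j : Fin n) :
    Module.End R (MvPolynomial (Fin n) R) :=
  LinearMap.mulLeft R (X j)

/-- The formal `j`-th partial derivative, as an `R`-linear endomorphism of
`R[X_1, …, X_n]`. -/
noncomputable def Dop {R : Type*} [CommRing R] {n : ℕ} (j : Fin n) :
    Module.End R (MvPolynomial (Fin n) R) :=
  (pderiv j).toLinearMap

/-- The `j`-th Euler operator `E_j = X̂_j ∘ D_j`. -/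
noncomputable def Eop {R : Type*} [CommRing R] {n : ℕ} (j : Fin n) :
    Module.End R (MvPolynomial (Fin n) R) :=
  Xhat j * Dop j

theorem prod_ofFn_mul_prod_ofFn {A : Type*} [Monoid A] {n : ℕ} (f g : Fin n → A)
    (h : ∀ i j, i ≠ j → Commute (f i) (g j)) :
    (List.ofFn f).prod * (List.ofFn g).prod = (List.ofFn fun j => f j * g j).prod := by
  induction n with
  | zero => simp
  | succ n ih =>
    have hc : Commute (List.ofFn fun i : Fin n => f i.succ).prod (g 0) := by
      apply Commute.list_prod_left
      intro x hx
      obtain ⟨i, rfl⟩ := List.mem_ofFn.1 hx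
      exact h _ _ (Fin.succ_ne_zero i)
    simp only [List.ofFn_succ, List.prod_cons]
    rw [← ih _ _ fun i j hij => h _ _ fun e => hij (Fin.succ_injective _ e), mul_assoc,
      ← mul_assoc _ (g 0), hc.eq]
    simp only [mul_assoc]

theorem pow_mul_pow_eq_prod_range_sub {A : Type*} [Ring A] {x d : A}
    (h : d * x = x * d + 1) (m : ℕ) :
    x ^ m * d ^ m = ((List.range m).map fun k => x * d - k • (1 : A)).prod := by
  have hd : ∀ m : ℕ, x * d * d ^ m = d ^ m * (x * d - m • (1 : A)) := by
    intro m
    induction m with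
    | zero => simp
    | succ m ih =>
      have h' : x * d * d = d * (x * d) - d := by
        rw [← mul_assoc d, h]; noncomm_ring
      rw [pow_succ, ← mul_assoc, ih, mul_assoc, mul_assoc, sub_mul, h']
      congr 1
      rw [succ_nsmul, mul_sub, mul_add, mul_one, smul_one_mul, mul_smul_one]
      abel
  induction m with
  | zero => simp
  | succ m ih =>
    rw [List.range_succ, List.map_append, List.prod_append, ← ih, pow_succ, pow_succ']
    simp only [List.map_cons, List.map_nil, List.prod_cons, List.prod_nil, mul_one]
    rw [mul_assoc (x ^ m) (d ^ m), ← hd]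
    simp only [mul_assoc]

theorem pow_mul_pow_eq_prod_range_add {A : Type*} [Ring A] {x d : A}
    (h : d * x = x * d + 1) (m : ℕ) :
    d ^ m * x ^ m = ((List.range m).map fun k => x * d + (k + 1) • (1 : A)).prod := by
  have hx : ∀ m : ℕ, d * x * x ^ m = x ^ m * (x * d + (m + 1) • (1 : A)) := by
    intro m
    induction m with
    | zero => simp [h]
    | succ m ih =>
      rw [pow_succ, ← mul_assoc, ih, mul_assoc, mul_assoc, add_mul, mul_assoc x d x, h]
      congr 1
      rw [succ_nsmul _ (m + 1), mul_add, mul_add, mul_add, mul_one, smul_one_mul, mul_smul_one]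
      abel
  induction m with
  | zero => simp
  | succ m ih =>
    rw [List.range_succ, List.map_append, List.prod_append, ← ih, pow_succ, pow_succ']
    simp only [List.map_cons, List.map_nil, List.prod_cons, List.prod_nil, mul_one]
    rw [mul_assoc (d ^ m) (x ^ m), ← hx]
    simp only [mul_assoc]

section WeylRelations

variable {R : Type*} [CommRing R] {n : ℕ}

theorem Dop_mul_Xhat_self (j : Fin n) :
    Dop (R := R) j * Xhat j = Xhat j * Dop j + 1 := by
  refine LinearMap.ext fun p => ?_
  simp [Dop, Xhat]

theorem commute_Xhat_Xhat (i j : Fin n) : Commute (Xhat (R := R) i) (Xhat j) := by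
  refine LinearMap.ext fun p => ?_
  simp [Xhat, mul_left_comm]

theorem commute_Xhat_Dop {i j : Fin n} (hij : i ≠ j) :
    Commute (Xhat (R := R) i) (Dop j) := by
  refine LinearMap.ext fun p => ?_
  simp [Xhat, Dop, pderiv_X_of_ne hij]

theorem commute_Dop_Dop (i j : Fin n) : Commute (Dop (R := R) i) (Dop j) := by
  let D : Fin n → Derivation R (MvPolynomial (Fin n) R) (MvPolynomial (Fin n) R) :=
    fun k => pderiv k
  have h : ⁅D i, D j⁆ = 0 := by
    refine MvPolynomial.derivation_ext fun k => ?_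
    simp [D, Derivation.commutator_apply, pderiv_X, Pi.single_apply, apply_ite]
  refine LinearMap.ext fun p => ?_
  have hp := DFunLike.congr_fun h p
  simpa [D, Derivation.commutator_apply, sub_eq_zero, Dop] using hp

end WeylRelations

/-- The operator identity
`(∏_j X̂_j^{a_j}) ∘ (∏_j D_j^{b_j}) ∘ (∏_j D_j^{a_j}) ∘ (∏_j X̂_j^{b_j})
  = ∏_j ∏_{k=0}^{a_j-1}(E_j - k) · ∏_j ∏_{k=1}^{b_j}(E_j + k)`
in `End_R(R[X_1, …, X_n])`.  All factors in each displayed product pairwise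
commute, so the products are unambiguously expressed as products of lists. -/
theorem xhat_dop_dop_xhat_eq_euler_prod {R : Type*} [CommRing R] {n : ℕ}
    (a b : Fin n → ℕ) :
    (List.ofFn fun j => Xhat (R := R) j ^ a j).prod *
      (List.ofFn fun j => Dop (R := R) j ^ b j).prod *
      (List.ofFn fun j => Dop (R := R) j ^ a j).prod *
      (List.ofFn fun j => Xhat (R := R) j ^ b j).prod =
    (List.ofFn fun j : Fin n =>
        ((List.range (a j)).map fun k =>
          Eop (R := R) j - k • (1 : Module.End R (MvPolynomial (Fin n) R))).prod).prod *
    (List.ofFn fun j : Fin n =>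
        ((List.range (b j)).map fun k =>
          Eop (R := R) j + (k + 1) • (1 : Module.End R (MvPolynomial (Fin n) R))).prod).prod := by
  have hxd : ∀ i j : Fin n, i ≠ j → ∀ k l : ℕ, Commute (Xhat (R := R) i ^ k) (Dop j ^ l) :=
    fun i j hij k l => (commute_Xhat_Dop hij).pow_pow k l
  have hdx : ∀ i j : Fin n, i ≠ j → ∀ k l : ℕ, Commute (Dop (R := R) i ^ k) (Xhat j ^ l) :=
    fun i j hij k l => (hxd j i hij.symm l k).symm
  have hxx : ∀ (i j : Fin n) (k l : ℕ), Commute (Xhat (R := R) i ^ k) (Xhat j ^ l) :=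
    fun i j k l => (commute_Xhat_Xhat i j).pow_pow k l
  have hdd : ∀ (i j : Fin n) (k l : ℕ), Commute (Dop (R := R) i ^ k) (Dop j ^ l) :=
    fun i j k l => (commute_Dop_Dop i j).pow_pow k l
  simp only [Eop, ← pow_mul_pow_eq_prod_range_sub (Dop_mul_Xhat_self _),
    ← pow_mul_pow_eq_prod_range_add (Dop_mul_Xhat_self _)]
  rw [prod_ofFn_mul_prod_ofFn _ _ fun i j hij => hxd i j hij _ _,
    prod_ofFn_mul_prod_ofFn _ _ fun i j hij => (hxd i j hij _ _).mul_left (hdd i j _ _),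
    prod_ofFn_mul_prod_ofFn _ _ fun i j hij =>
      ((hxx i j _ _).mul_left (hdx i j hij _ _)).mul_left (hdx i j hij _ _),
    prod_ofFn_mul_prod_ofFn _ _ fun i j hij =>
      ((hxd i j hij _ _).mul_right (hxx i j _ _)).mul_left
        ((hdd i j _ _).mul_right (hdx i j hij _ _))]
  congr 2
  funext j
  rw [mul_assoc (Xhat j ^ a j), (hdd j j _ _).eq]
  simp only [mul_assoc]
end

section
/- For all functions a, b, α : Fin n → ℕ, the operator (∏_{j} X̂_j^{a_j}) ∘ (∏_{j} D_j^{b_j}) ∘ (∏_{j} D_j^{a_j}) ∘ (∏_{j} X̂_j^{b_j}) sends the monomial ∏_j X_j^{α_j} to c · ∏_j X_j^{α_j}, where c ∈ R is the scalar c = ∏_{j} ( ∏_{k=0}^{a_j−1} ((α_j : R) − (k : R)) ) · ( ∏_{k=1}^{b_j} ((α_j : R) + (k : R)) ). In particular, every monomial is an eigenvector of this operator, with eigenvalue given by the stated product of shifted exponents. (This computes the action of the operators f̃_v·g̃_v of the paper on weight vectors, which underlies the determination of their common roots in 𝔱^*(F_p).) -/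
open MvPolynomial

/-- If each `T j` acts on monomials by rescaling and changing only the `j`-th exponent, then a
product of distinct `T j` rescales and changes each of the corresponding exponents. -/
lemma list_prod_apply_prod_X_pow {R ι : Type*} [CommRing R] [Fintype ι] [DecidableEq ι]
    (T : ι → Module.End R (MvPolynomial ι R)) (c : ι → ℕ → R) (s : ι → ℕ → ℕ)
    (hT : ∀ j (γ : ι → ℕ), T j (∏ i, X i ^ γ i) =
      c j (γ j) • ∏ i, X i ^ Function.update γ j (s j (γ j)) i)
    (l : List ι) (hl : l.Nodup) (γ : ι → ℕ) :
    (l.map T).prod (∏ i, X i ^ γ i) =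
      (l.map fun j => c j (γ j)).prod • ∏ i, X i ^ (if i ∈ l then s i (γ i) else γ i) := by
  induction l with
  | nil => simp
  | cons j l ih =>
    obtain ⟨hj, hl⟩ := List.nodup_cons.mp hl
    rw [List.map_cons, List.prod_cons, Module.End.mul_apply, ih hl, map_smul, hT, smul_smul,
      List.map_cons, List.prod_cons, mul_comm, if_neg hj]
    congr 1
    refine Finset.prod_congr rfl fun i _ => ?_
    by_cases h : i = j
    · subst h; simp
    · simp [h]

lemma ofFn_prod_apply_prod_X_pow {R : Type*} [CommRing R] {n : ℕ}
    (T : Fin n → Module.End R (MvPolynomial (Fin n) R)) (c : Fin n → ℕ → R) (s : Fin n → ℕ → ℕ)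
    (hT : ∀ j (γ : Fin n → ℕ), T j (∏ i, X i ^ γ i) =
      c j (γ j) • ∏ i, X i ^ Function.update γ j (s j (γ j)) i)
    (γ : Fin n → ℕ) :
    (List.ofFn T).prod (∏ i, X i ^ γ i) = (∏ j, c j (γ j)) • ∏ i, X i ^ s i (γ i) := by
  rw [List.ofFn_eq_map, list_prod_apply_prod_X_pow T c s hT _ (List.nodup_finRange n),
    ← List.ofFn_eq_map, List.prod_ofFn]
  simp

lemma Xhat_pow_apply {R : Type*} [CommRing R] {n : ℕ} (j : Fin n) (m : ℕ)
    (p : MvPolynomial (Fin n) R) : (Xhat j ^ m) p = X j ^ m * p := by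
  rw [Xhat, LinearMap.pow_mulLeft, LinearMap.mulLeft_apply]

lemma Xhat_pow_prod_X_pow {R : Type*} [CommRing R] {n : ℕ} (j : Fin n) (m : ℕ)
    (γ : Fin n → ℕ) :
    (Xhat j ^ m) (∏ i, (X i : MvPolynomial (Fin n) R) ^ γ i) =
      ∏ i, X i ^ Function.update γ j (γ j + m) i := by
  rw [Xhat_pow_apply, ← Finset.mul_prod_erase _ _ (Finset.mem_univ j),
    ← Finset.mul_prod_erase _ (fun i => X i ^ Function.update γ j (γ j + m) i)
      (Finset.mem_univ j), ← mul_assoc, ← pow_add, Function.update_self, add_comm m]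
  congr 1
  exact Finset.prod_congr rfl fun i hi => by rw [Function.update_of_ne (Finset.ne_of_mem_erase hi)]

lemma Dop_prod_X_pow {R : Type*} [CommRing R] {n : ℕ} (j : Fin n) (γ : Fin n → ℕ) :
    Dop j (∏ i, (X i : MvPolynomial (Fin n) R) ^ γ i) =
      (γ j : R) • ∏ i, X i ^ Function.update γ j (γ j - 1) i := by
  have key (δ : Fin n → ℕ) : ∏ i, (X i : MvPolynomial (Fin n) R) ^ δ i =
      monomial (Finsupp.equivFunOnFinite.symm δ) 1 := by
    rw [monomial_eq, Finsupp.prod_fintype _ _ (by simp)]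
    simp
  rw [key, key]
  change pderiv j _ = _
  have hγ : Finsupp.equivFunOnFinite.symm γ - Finsupp.single j 1 =
      Finsupp.equivFunOnFinite.symm (Function.update γ j (γ j - 1)) := by
    ext i
    by_cases h : i = j
    · subst h; simp
    · simp [h]
  rw [pderiv_monomial, smul_monomial, hγ]
  simp

lemma Dop_pow_prod_X_pow {R : Type*} [CommRing R] {n : ℕ} (j : Fin n) (m : ℕ)
    (γ : Fin n → ℕ) :
    (Dop j ^ m) (∏ i, (X i : MvPolynomial (Fin n) R) ^ γ i) =
      ((γ j).descFactorial m : R) • ∏ i, X i ^ Function.update γ j (γ j - m) i := by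
  induction m with
  | zero => simp
  | succ m ih =>
    rw [pow_succ', Module.End.mul_apply, ih, map_smul, Dop_prod_X_pow, smul_smul,
      Function.update_self, Function.update_idem, Nat.descFactorial_succ, Nat.cast_mul, mul_comm,
      Nat.sub_sub]

lemma Nat.cast_descFactorial_eq_prod_range_sub (R : Type*) [CommRing R] (n m : ℕ) :
    (n.descFactorial m : R) = ∏ k ∈ Finset.range m, ((n : R) - k) := by
  induction m with
  | zero => simp
  | succ m ih =>
    rw [Finset.prod_range_succ, ← ih, Nat.descFactorial_succ, Nat.cast_mul, mul_comm]
    rcases le_or_gt m n with h | h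
    · rw [Nat.cast_sub h]
    · simp [Nat.descFactorial_of_lt h]

lemma Nat.add_descFactorial_mul_descFactorial (n a b : ℕ) :
    (n + b).descFactorial a * (n + b - a).descFactorial b =
      n.descFactorial a * (n + 1).ascFactorial b := by
  have h₁ := Nat.descFactorial_mul_descFactorial (n := n + b) (Nat.le_add_right a b)
  have h₂ := Nat.descFactorial_mul_descFactorial (n := n + b) (Nat.le_add_left b a)
  rw [Nat.add_sub_cancel_left] at h₁
  rw [Nat.add_sub_cancel, Nat.add_sub_cancel] at h₂
  rw [mul_comm, h₁, ← h₂, Nat.add_descFactorial_eq_ascFactorial]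

/-- The operator `(∏_j X̂_j^{a_j}) ∘ (∏_j D_j^{b_j}) ∘ (∏_j D_j^{a_j}) ∘ (∏_j X̂_j^{b_j})`
sends the monomial `∏_j X_j^{α_j}` to `c • ∏_j X_j^{α_j}` with eigenvalue
`c = ∏_j (∏_{k=0}^{a_j-1} (α_j - k)) · (∏_{k=1}^{b_j} (α_j + k)) ∈ R`.
In particular every monomial is an eigenvector of this operator.  The factors
in each of the operator products pairwise commute, so those products are
unambiguously expressed as products of lists. -/
theorem monomial_eigenvector_of_xhat_dop_dop_xhat {R : Type*} [CommRing R] {n : ℕ}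
    (a b α : Fin n → ℕ) :
    ((List.ofFn fun j => Xhat (R := R) j ^ a j).prod *
      (List.ofFn fun j => Dop (R := R) j ^ b j).prod *
      (List.ofFn fun j => Dop (R := R) j ^ a j).prod *
      (List.ofFn fun j => Xhat (R := R) j ^ b j).prod)
      (∏ j, (X j : MvPolynomial (Fin n) R) ^ α j) =
    (∏ j, ((∏ k ∈ Finset.range (a j), ((α j : R) - (k : R))) *
        (∏ k ∈ Finset.range (b j), ((α j : R) + ((k : R) + 1))))) •
      ∏ j, (X j : MvPolynomial (Fin n) R) ^ α j := by
  rw [Module.End.mul_apply, Module.End.mul_apply, Module.End.mul_apply,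
    ofFn_prod_apply_prod_X_pow _ (fun _ _ => 1) (fun j m => m + b j)
      (fun j γ => by rw [Xhat_pow_prod_X_pow, one_smul]), Finset.prod_const_one, one_smul,
    ofFn_prod_apply_prod_X_pow _ (fun j m => (m.descFactorial (a j) : R)) (fun j m => m - a j)
      (fun j γ => Dop_pow_prod_X_pow j _ γ), map_smul,
    ofFn_prod_apply_prod_X_pow _ (fun j m => (m.descFactorial (b j) : R)) (fun j m => m - b j)
      (fun j γ => Dop_pow_prod_X_pow j _ γ), map_smul, map_smul,
    ofFn_prod_apply_prod_X_pow _ (fun _ _ => 1) (fun j m => m + a j)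
      (fun j γ => by rw [Xhat_pow_prod_X_pow, one_smul])]
  simp only [Finset.prod_const_one, one_smul, smul_smul]
  rw [← Finset.prod_mul_distrib]
  have hc (j : Fin n) : ((α j + b j).descFactorial (a j) : R) *
      ((α j + b j - a j).descFactorial (b j) : R) =
      (∏ k ∈ Finset.range (a j), ((α j : R) - (k : R))) *
        ∏ k ∈ Finset.range (b j), ((α j : R) + ((k : R) + 1)) := by
    rw [← Nat.cast_mul, Nat.add_descFactorial_mul_descFactorial, Nat.cast_mul,
      Nat.cast_descFactorial_eq_prod_range_sub, Nat.ascFactorial_eq_prod_range]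
    push_cast
    simp only [add_assoc, add_comm (1 : R)]
  simp only [hc]
  by_cases h : ∀ j, a j ≤ α j
  · congr 1
    refine Finset.prod_congr rfl fun j _ => ?_
    congr 1
    have := h j
    omega
  · push Not at h
    obtain ⟨j, hj⟩ := h
    rw [Finset.prod_eq_zero (Finset.mem_univ j), zero_smul, zero_smul]
    rw [Finset.prod_eq_zero (Finset.mem_range.mpr hj) (sub_self _), zero_mul]
end

section
/- Let α and β be finite types, let W be a finite subset (Finset) of β, and let k be a natural number with k ≤ card(α). Then the number of functions a : α → β such that the number of indices j : α with a(j) ∉ W is at most k is bounded above by C(card(α), k) · card(β)^k · card(W)^(card(α) − k), where C(·,·) denotes the binomial coefficient. (This is the counting estimate used in the paper to bound the number of common roots of the operators g̃_v f̃_v, showing that at most C(n, dim𝔤−1)(2N)^{n−dim𝔤+1} p^{dim𝔤−1} tuples can be common roots.) -/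
/-- The number of functions that map every point outside `S` into `W`. -/
lemma card_piFinset_ite_univ {α β : Type*} [Fintype α] [DecidableEq α] [Fintype β]
    (S : Finset α) (W : Finset β) :
    (Fintype.piFinset fun j : α => if j ∈ S then Finset.univ else W).card =
      Fintype.card β ^ S.card * W.card ^ (Fintype.card α - S.card) := by
  simp only [Fintype.card_piFinset, apply_ite Finset.card, Finset.card_univ]
  rw [Finset.prod_ite, Finset.prod_const, Finset.prod_const, Finset.filter_not,
    Finset.filter_univ_mem, ← Finset.compl_eq_univ_sdiff, Finset.card_compl]

/-- Counting estimate: for finite types `α, β`, a finite subset `W ⊆ β` and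
`k ≤ card α`, the number of functions `a : α → β` such that at most `k`
indices `j` have `a j ∉ W` is at most
`C(card α, k) · (card β)^k · (card W)^(card α - k)`. -/
theorem card_functions_with_few_outside_le {α β : Type*} [Fintype α] [Fintype β]
    [DecidableEq β] (W : Finset β) (k : ℕ) (hk : k ≤ Fintype.card α) :
    Nat.card {a : α → β //
        (Finset.univ.filter fun j : α => a j ∉ W).card ≤ k} ≤
      (Fintype.card α).choose k * (Fintype.card β) ^ k *
        W.card ^ (Fintype.card α - k) := by
  classical
  rw [Nat.card_eq_fintype_card, Fintype.card_subtype, mul_assoc, ← Finset.card_univ (α := α),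
    ← Finset.card_powersetCard, Finset.card_univ]
  calc
    _ ≤ ((Finset.univ.powersetCard k).biUnion fun S : Finset α =>
          Fintype.piFinset fun j => if j ∈ S then Finset.univ else W).card := by
      refine Finset.card_le_card fun a ha => ?_
      obtain ⟨S, hS, hcard⟩ := Finset.exists_superset_card_eq (Finset.mem_filter.mp ha).2 hk
      simp only [Finset.mem_biUnion, Finset.mem_powersetCard_univ, Fintype.mem_piFinset]
      refine ⟨S, hcard, fun j => ?_⟩
      split_ifs with hj
      · exact Finset.mem_univ _
      · by_contra hW
        exact hj (hS (by simpa using hW))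
    _ ≤ _ := Finset.card_biUnion_le_card_mul _ _ _ fun S hS => by
      rw [card_piFinset_ite_univ, Finset.mem_powersetCard_univ.mp hS]
end

section
/- Let p be a prime, let n ≥ d ≥ 1 be natural numbers, and let N ≥ 1 be a natural number. Let W ⊆ ZMod p be the image of the set of integers j with −N ≤ j < N under the canonical ring map ℤ → ZMod p (so W has at most 2N elements). Then the number of tuples a : Fin n → ZMod p such that every subset S of Fin n of cardinality d contains an index j with a(j) ∈ W is at most C(n, d−1) · (2N)^(n−d+1) · p^(d−1), where C(·,·) denotes the binomial coefficient. (This is the bound on the intersection ⋂_i ⋃_{j ∈ S_i} of coordinate-window conditions used in the paper's proof that for p > C(n,dim𝔤−1)(2N)^{n−dim𝔤+1} there exists an integral parameter Λ with Λ ≤ Λδ for the hypertoric quantum Hamiltonian reduction.) -/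
/-- If among any `k + 1` coordinates of a tuple at least one lies in `W`, then all coordinates
outside some `k`-element set lie in `W`; this bounds the number of such tuples. -/
theorem card_filter_forall_exists_mem_le {ι α : Type*} [Fintype ι] [DecidableEq ι]
    [Fintype α] [DecidableEq α] (W : Finset α) (k : ℕ) (hk : k ≤ Fintype.card ι) :
    (Finset.univ.filter fun a : ι → α =>
        ∀ S : Finset ι, S.card = k + 1 → ∃ j ∈ S, a j ∈ W).card ≤
      (Fintype.card ι).choose k * (W.card ^ (Fintype.card ι - k) * Fintype.card α ^ k) := by
  have hsub : (Finset.univ.filter fun a : ι → α =>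
      ∀ S : Finset ι, S.card = k + 1 → ∃ j ∈ S, a j ∈ W) ⊆
      (Finset.powersetCard k Finset.univ).biUnion fun T : Finset ι =>
        Fintype.piFinset fun j => if j ∈ T then Finset.univ else W := by
    intro a ha
    rw [Finset.mem_filter_univ] at ha
    have hB : (Finset.univ.filter fun j => a j ∉ W).card ≤ k := by
      by_contra! h
      obtain ⟨S, hS, hcard⟩ := Finset.exists_subset_card_eq (Nat.succ_le_of_lt h)
      obtain ⟨j, hj, hjW⟩ := ha S hcard
      exact (Finset.mem_filter.mp (hS hj)).2 hjW
    obtain ⟨T, hT, hcard⟩ := Finset.exists_superset_card_eq hB hk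
    rw [Finset.mem_biUnion]
    refine ⟨T, by simp [hcard], Fintype.mem_piFinset.mpr fun j => ?_⟩
    split_ifs with hj
    · exact Finset.mem_univ _
    · by_contra hjW
      exact hj (hT (by simpa using hjW))
  refine (Finset.card_le_card hsub).trans ?_
  refine (Finset.card_biUnion_le_card_mul _ _
    (W.card ^ (Fintype.card ι - k) * Fintype.card α ^ k) fun T hT => ?_).trans ?_
  · have hcard := (Finset.mem_powersetCard.mp hT).2
    rw [Fintype.card_piFinset]
    simp only [apply_ite Finset.card, Finset.prod_ite, Finset.prod_const, Finset.card_univ]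
    rw [Finset.filter_mem_eq_inter, Finset.univ_inter, Finset.filter_not,
      Finset.filter_mem_eq_inter, Finset.univ_inter, Finset.card_univ_sdiff, hcard, mul_comm]
  · rw [Finset.card_powersetCard, Finset.card_univ]

/-- Let `p` be a prime, `n ≥ d ≥ 1`, `N ≥ 1`, and let `W ⊆ ZMod p` be the image
of the integers `j` with `-N ≤ j < N` under the canonical map `ℤ → ZMod p`.
Then the number of tuples `a : Fin n → ZMod p` such that every `d`-element
subset `S` of `Fin n` contains an index `j` with `a j ∈ W` is at most
`C(n, d-1) · (2N)^(n-d+1) · p^(d-1)`.  (This is the bound on the intersection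
of coordinate-window conditions used in the hypertoric localization bound.) -/
theorem card_tuples_window_condition_le (p : ℕ) [Fact p.Prime] (n d N : ℕ)
    (hd : 1 ≤ d) (hdn : d ≤ n) (hN : 1 ≤ N) :
    Nat.card {a : Fin n → ZMod p //
        ∀ S : Finset (Fin n), S.card = d → ∃ j ∈ S,
          a j ∈ (Finset.Ico (-(N : ℤ)) (N : ℤ)).image (fun j : ℤ => (j : ZMod p))} ≤
      n.choose (d - 1) * (2 * N) ^ (n - d + 1) * p ^ (d - 1) := by
  obtain ⟨k, rfl⟩ := Nat.exists_eq_add_of_le' hd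
  rw [Nat.card_eq_fintype_card, Fintype.card_subtype]
  set W := (Finset.Ico (-(N : ℤ)) (N : ℤ)).image (fun j : ℤ => (j : ZMod p))
  have hW : W.card ≤ 2 * N := by
    refine Finset.card_image_le.trans ?_
    rw [Int.card_Ico]
    omega
  have h := card_filter_forall_exists_mem_le (ι := Fin n) W k (by simp; omega)
  rw [Fintype.card_fin, ZMod.card] at h
  rw [Nat.add_sub_cancel, show n - (k + 1) + 1 = n - k by omega, mul_assoc]
  refine le_trans (le_of_eq ?_) (h.trans ?_)
  · congr
  · gcongr
end
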